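/- arXiv:0912.5209 — 4 statements merged into one kernel-verified Lean document; each statement's English description precedes it below -/
import Mathlib

section
/- For every h-normal Γ-linear connection of Cartan type, the following local Bianchi identities hold for all indices l, i, j, k, p: (15) (P^l_i1(p))_|k − (P^l_ik(p))_/1 + Pv^r_1p P^l_ik(r) − Pv^r_kp P^l_i1(r) = (R^l_i1k)|_(p) + Rv^r_1k S^l_i(p)(r) + C^r_kp R^l_i1r − T^r_1k P^l_ir(p), and (16) A_{j,k}{ R^l_ijr C^r_kp + P^l_ij(r) Pv^r_kp + (P^l_ik(p))_|j } = −S^l_i(p)(r) Rv^r_jk − (R^l_ijk)|_(p). -/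
open Finset

noncomputable section

namespace Jet

/-- Smooth real-valued functions of `(t, x, y) ∈ ℝ × ℝⁿ × ℝⁿ`, the local coordinates
of the 1-jet space `J¹(ℝ, M)`. -/
abbrev Fn (n : ℕ) : Type := ℝ → (Fin n → ℝ) → (Fin n → ℝ) → ℝ

def Smooth {n : ℕ} (F : Fn n) : Prop :=
  ContDiff ℝ (⊤ : ℕ∞) (fun p : ℝ × (Fin n → ℝ) × (Fin n → ℝ) => F p.1 p.2.1 p.2.2)

/-- Partial derivative in the time variable `t`. -/
def pt {n : ℕ} (F : Fn n) : Fn n := fun t x y => deriv (fun s => F s x y) t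

/-- Partial derivative in the spatial variable `xⁱ`. -/
def px {n : ℕ} (i : Fin n) (F : Fn n) : Fn n :=
  fun t x y => deriv (fun s => F t (Function.update x i s) y) (x i)

/-- Partial derivative in the fibre variable `yⁱ`. -/
def py {n : ℕ} (i : Fin n) (F : Fn n) : Fn n :=
  fun t x y => deriv (fun s => F t x (Function.update y i s)) (y i)

/-- Kronecker delta, as a constant function on the jet space. -/
def kron {n : ℕ} (i j : Fin n) : Fn n := if i = j then 1 else 0

/-- The coordinate function `yⁱ`. -/
def yc {n : ℕ} (i : Fin n) : Fn n := fun _ _ y => y i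

/-- The Christoffel symbol `κ(t) = (1/(2h)) dh/dt` of a Riemannian metric `h` on `ℝ`,
as a function on the jet space. -/
def chr {n : ℕ} (h : ℝ → ℝ) : Fn n := fun t _ _ => deriv h t / (2 * h t)

/-- The metric `h(t)` as a function on the jet space. -/
def hfun {n : ℕ} (h : ℝ → ℝ) : Fn n := fun t _ _ => h t

/-- The derivative `dh/dt` as a function on the jet space. -/
def hder {n : ℕ} (h : ℝ → ℝ) : Fn n := fun t _ _ => deriv h t

variable {n : ℕ}

/-- The adapted temporal derivative `δ/δt = ∂/∂t − Mʳ ∂/∂yʳ` determined by a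
nonlinear connection `(M, N)`. -/
def dt (M : Fin n → Fn n) (F : Fn n) : Fn n := pt F - ∑ r, M r * py r F

/-- The adapted spatial derivative `δ/δxᵏ = ∂/∂xᵏ − Nʳₖ ∂/∂yʳ`. -/
def dx (N : Fin n → Fin n → Fn n) (k : Fin n) (F : Fn n) : Fn n :=
  px k F - ∑ r, N r k * py r F

/-- An `h`-normal `Γ`-linear connection `(κ, Gᵏᵢ, Lᵏᵢⱼ, Cᵏᵢⱼ)`. -/
structure Conn (n : ℕ) where
  κ : Fn n
  G : Fin n → Fin n → Fn n
  L : Fin n → Fin n → Fin n → Fn n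
  C : Fin n → Fin n → Fin n → Fn n

/-! ### Torsion d-tensors -/

/-- `Tʳ₁ⱼ = −Gʳⱼ`. -/
def T1 (Γ : Conn n) (r j : Fin n) : Fn n := -Γ.G r j

/-- `Rvʳ₁ⱼ = (δ/δxʲ)Mʳ − (δ/δt)Nʳⱼ`. -/
def Rv1 (M : Fin n → Fn n) (N : Fin n → Fin n → Fn n) (r j : Fin n) : Fn n :=
  dx N j (M r) - dt M (N r j)

/-- `Tʳᵢⱼ = Lʳᵢⱼ − Lʳⱼᵢ`. -/
def Tsp (Γ : Conn n) (r i j : Fin n) : Fn n := Γ.L r i j - Γ.L r j i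

/-- `Rvʳᵢⱼ = (δ/δxʲ)Nʳᵢ − (δ/δxⁱ)Nʳⱼ`. -/
def Rvsp (M : Fin n → Fn n) (N : Fin n → Fin n → Fn n) (r i j : Fin n) : Fn n :=
  dx N j (N r i) - dx N i (N r j)

/-- `Pvʳ₁ⱼ = ∂Mʳ/∂yʲ − Gʳⱼ + δʳⱼ κ`. -/
def Pv1 (M : Fin n → Fn n) (Γ : Conn n) (r j : Fin n) : Fn n :=
  py j (M r) - Γ.G r j + kron r j * Γ.κ

/-- `Phʳᵢⱼ = Cʳᵢⱼ`. -/
def Phsp (Γ : Conn n) (r i j : Fin n) : Fn n := Γ.C r i j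

/-- `Pvʳᵢⱼ = ∂Nʳᵢ/∂yʲ − Lʳⱼᵢ`. -/
def Pvsp (N : Fin n → Fin n → Fn n) (Γ : Conn n) (r i j : Fin n) : Fn n :=
  py j (N r i) - Γ.L r j i

/-- `Sʳᵢⱼ = Cʳᵢⱼ − Cʳⱼᵢ`. -/
def Ssp (Γ : Conn n) (r i j : Fin n) : Fn n := Γ.C r i j - Γ.C r j i

/-! ### Generic covariant derivatives of d-tensors -/

/-- Index types of the (valued) indices of a d-tensor: upper/lower spatial,
upper/lower vertical.  (Temporal indices carry no value; they are accounted for by the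
temporal weight `p` = number of upper temporal indices minus number of lower temporal
indices.) -/
inductive IdxType | uS | lS | uV | lV

/-- A d-tensor component family with `m` valued indices. -/
abbrev Tensor (n m : ℕ) := (Fin m → Fin n) → Fn n

/-- The `ℝ`-horizontal covariant derivative `D_{/1}` of a d-tensor `D` with valued index
signature `σ` and temporal weight `p`. -/
def covT {m : ℕ} (M : Fin n → Fn n) (Γ : Conn n) (p : ℤ) (σ : Fin m → IdxType)
    (D : Tensor n m) : Tensor n m := fun a =>
  dt M (D a) + p • (Γ.κ * D a)
    + ∑ q : Fin m,
      (match σ q with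
      | .uS => ∑ r, D (Function.update a q r) * Γ.G (a q) r
      | .lS => -∑ r, D (Function.update a q r) * Γ.G r (a q)
      | .uV => ∑ r, D (Function.update a q r) * (Γ.G (a q) r - kron (a q) r * Γ.κ)
      | .lV => -∑ r, D (Function.update a q r) * (Γ.G r (a q) - kron r (a q) * Γ.κ) : Fn n)

/-- The `M`-horizontal covariant derivative `D_{|k}`. -/
def covX {m : ℕ} (N : Fin n → Fin n → Fn n) (Γ : Conn n) (σ : Fin m → IdxType)
    (k : Fin n) (D : Tensor n m) : Tensor n m := fun a =>
  dx N k (D a)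
    + ∑ q : Fin m,
      (match σ q with
      | .uS => ∑ r, D (Function.update a q r) * Γ.L (a q) r k
      | .uV => ∑ r, D (Function.update a q r) * Γ.L (a q) r k
      | .lS => -∑ r, D (Function.update a q r) * Γ.L r (a q) k
      | .lV => -∑ r, D (Function.update a q r) * Γ.L r (a q) k : Fn n)

/-- The vertical covariant derivative `D|_{(k)}`. -/
def covY {m : ℕ} (Γ : Conn n) (σ : Fin m → IdxType)
    (k : Fin n) (D : Tensor n m) : Tensor n m := fun a =>
  py k (D a)
    + ∑ q : Fin m,
      (match σ q with
      | .uS => ∑ r, D (Function.update a q r) * Γ.C (a q) r k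
      | .uV => ∑ r, D (Function.update a q r) * Γ.C (a q) r k
      | .lS => -∑ r, D (Function.update a q r) * Γ.C r (a q) k
      | .lV => -∑ r, D (Function.update a q r) * Γ.C r (a q) k : Fn n)

/-- The coefficients `Cᵏᵢⱼ` viewed as a d-tensor with signature
(upper spatial, lower spatial, lower vertical). -/
def CT (Γ : Conn n) : Tensor n 3 := fun a => Γ.C (a 0) (a 1) (a 2)

/-- The signature of `Cᵏᵢⱼ`. -/
def sigC : Fin 3 → IdxType := ![IdxType.uS, IdxType.lS, IdxType.lV]

/-! ### Curvature d-tensors -/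

/-- `Rˡᵢ₁ₖ`. -/
def Rc1 (M : Fin n → Fn n) (N : Fin n → Fin n → Fn n) (Γ : Conn n) (l i k : Fin n) : Fn n :=
  dx N k (Γ.G l i) - dt M (Γ.L l i k) + ∑ r, Γ.G r i * Γ.L l r k
    - ∑ r, Γ.L r i k * Γ.G l r + ∑ r, Γ.C l i r * Rv1 M N r k

/-- `Rˡᵢⱼₖ`. -/
def Rc (M : Fin n → Fn n) (N : Fin n → Fin n → Fn n) (Γ : Conn n) (l i j k : Fin n) : Fn n :=
  dx N k (Γ.L l i j) - dx N j (Γ.L l i k) + ∑ r, Γ.L r i j * Γ.L l r k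
    - ∑ r, Γ.L r i k * Γ.L l r j + ∑ r, Γ.C l i r * Rvsp M N r j k

/-- `Pˡᵢ₁₍ₖ₎`. -/
def Pc1 (M : Fin n → Fn n) (N : Fin n → Fin n → Fn n) (Γ : Conn n) (l i k : Fin n) : Fn n :=
  py k (Γ.G l i) - covT M Γ 0 sigC (CT Γ) ![l, i, k] + ∑ r, Γ.C l i r * Pv1 M Γ r k

/-- `Pˡᵢⱼ₍ₖ₎`. -/
def Pc (M : Fin n → Fn n) (N : Fin n → Fin n → Fn n) (Γ : Conn n) (l i j k : Fin n) : Fn n :=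
  py k (Γ.L l i j) - covX N Γ sigC j (CT Γ) ![l, i, k] + ∑ r, Γ.C l i r * Pvsp N Γ r j k

/-- `Sˡᵢ₍ⱼ₎₍ₖ₎`. -/
def Sc (Γ : Conn n) (l i j k : Fin n) : Fn n :=
  py k (Γ.C l i j) - py j (Γ.C l i k)
    + ∑ r, Γ.C r i j * Γ.C l r k - ∑ r, Γ.C r i k * Γ.C l r j

end Jet

namespace Jet

variable {n : ℕ}

/-- A family with one valued index, viewed as a d-tensor. -/
def famT (X : Fin n → Fn n) : Tensor n 1 := fun a => X (a 0)

def T1T (Γ : Conn n) : Tensor n 2 := fun a => T1 Γ (a 0) (a 1)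
def Rv1T (M : Fin n → Fn n) (N : Fin n → Fin n → Fn n) : Tensor n 2 :=
  fun a => Rv1 M N (a 0) (a 1)
def RvspT (M : Fin n → Fn n) (N : Fin n → Fin n → Fn n) : Tensor n 3 :=
  fun a => Rvsp M N (a 0) (a 1) (a 2)
def Pv1T (M : Fin n → Fn n) (Γ : Conn n) : Tensor n 2 := fun a => Pv1 M Γ (a 0) (a 1)
def PvspT (N : Fin n → Fin n → Fn n) (Γ : Conn n) : Tensor n 3 :=
  fun a => Pvsp N Γ (a 0) (a 1) (a 2)
def Rc1T (M : Fin n → Fn n) (N : Fin n → Fin n → Fn n) (Γ : Conn n) : Tensor n 3 :=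
  fun a => Rc1 M N Γ (a 0) (a 1) (a 2)
def RcT (M : Fin n → Fn n) (N : Fin n → Fin n → Fn n) (Γ : Conn n) : Tensor n 4 :=
  fun a => Rc M N Γ (a 0) (a 1) (a 2) (a 3)
def Pc1T (M : Fin n → Fn n) (N : Fin n → Fin n → Fn n) (Γ : Conn n) : Tensor n 3 :=
  fun a => Pc1 M N Γ (a 0) (a 1) (a 2)
def PcT (M : Fin n → Fn n) (N : Fin n → Fin n → Fn n) (Γ : Conn n) : Tensor n 4 :=
  fun a => Pc M N Γ (a 0) (a 1) (a 2) (a 3)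
def ScT (Γ : Conn n) : Tensor n 4 := fun a => Sc Γ (a 0) (a 1) (a 2) (a 3)

/-- valued-index signatures (temporal indices are tracked by the weight `p` only) -/
def sig0 : Fin 0 → IdxType := ![]
def siglS : Fin 1 → IdxType := ![IdxType.lS]
def siglV : Fin 1 → IdxType := ![IdxType.lV]
def sigU : Fin 1 → IdxType := ![IdxType.uS]
def sigV : Fin 1 → IdxType := ![IdxType.uV]
def sigUlS : Fin 2 → IdxType := ![IdxType.uS, IdxType.lS]
def sigUlV : Fin 2 → IdxType := ![IdxType.uS, IdxType.lV]
def sigVlS : Fin 2 → IdxType := ![IdxType.uV, IdxType.lS]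
def sigVlV : Fin 2 → IdxType := ![IdxType.uV, IdxType.lV]
def sigRvsp : Fin 3 → IdxType := ![IdxType.uV, IdxType.lS, IdxType.lS]
def sigPvsp : Fin 3 → IdxType := ![IdxType.uV, IdxType.lS, IdxType.lV]
def sigRc1 : Fin 3 → IdxType := ![IdxType.uS, IdxType.lS, IdxType.lS]
def sigRc : Fin 4 → IdxType := ![IdxType.uS, IdxType.lS, IdxType.lS, IdxType.lS]
def sigPc1 : Fin 3 → IdxType := ![IdxType.uS, IdxType.lS, IdxType.lV]
def sigPc : Fin 4 → IdxType := ![IdxType.uS, IdxType.lS, IdxType.lS, IdxType.lV]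
def sigSc : Fin 4 → IdxType := ![IdxType.uS, IdxType.lS, IdxType.lV, IdxType.lV]

end Jet

namespace Jet

/-- The differential Bianchi identity in an algebra `E` over `R`: `d₁`, `d₂` and `v p` are
derivations of `E` over derivations of `R`, their commutators are combinations of the `v r`, and
`A₁`, `A₂`, `C p` are the connection coefficients. -/
theorem bianchi_algebra {ι R E : Type*} [Fintype ι] [CommRing R] [Ring E] [Algebra R E]
    (δ₁ δ₂ : R → R) (dv : ι → R → R) (d₁ d₂ : E →+ E) (v : ι → E →+ E)
    (hd₁ : ∀ X Y, d₁ (X * Y) = d₁ X * Y + X * d₁ Y)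
    (hd₂ : ∀ X Y, d₂ (X * Y) = d₂ X * Y + X * d₂ Y)
    (hv : ∀ p X Y, v p (X * Y) = v p X * Y + X * v p Y)
    (hs₁ : ∀ f X, d₁ (f • X) = δ₁ f • X + f • d₁ X)
    (hs₂ : ∀ f X, d₂ (f • X) = δ₂ f • X + f • d₂ X)
    (hsv : ∀ p f X, v p (f • X) = dv p f • X + f • v p X)
    (m k : ι → ι → R) (w : ι → R)
    (h₁ : ∀ p X, d₁ (v p X) = v p (d₁ X) + ∑ r, m r p • v r X)
    (h₂ : ∀ p X, d₂ (v p X) = v p (d₂ X) + ∑ r, k r p • v r X)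
    (h₂₁ : ∀ X, d₂ (d₁ X) = d₁ (d₂ X) - ∑ r, w r • v r X)
    (hw : ∀ p r, dv p (w r) =
      δ₂ (m r p) - δ₁ (k r p) - ∑ s, k s p * m r s + ∑ s, m s p * k r s)
    (A₁ A₂ : E) (C P₁ P₂ : ι → E) (S : ι → ι → E) (F : E)
    (hP₁ : ∀ p, P₁ p = v p A₁ - d₁ (C p) - (A₁ * C p - C p * A₁) + ∑ r, m r p • C r)
    (hP₂ : ∀ p, P₂ p = v p A₂ - d₂ (C p) - (A₂ * C p - C p * A₂) + ∑ r, k r p • C r)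
    (hS : ∀ p q, S p q = v q (C p) - v p (C q) + (C q * C p - C p * C q))
    (hF : F = d₂ A₁ - d₁ A₂ + (A₂ * A₁ - A₁ * A₂) + ∑ r, w r • C r) (p : ι) :
    d₂ (P₁ p) + (A₂ * P₁ p - P₁ p * A₂) - (d₁ (P₂ p) + (A₁ * P₂ p - P₂ p * A₁))
        + ∑ r, m r p • P₂ r - ∑ r, k r p • P₁ r
      = v p F + (C p * F - F * C p) + ∑ r, w r • S p r := by
  have hswap : ∀ a b : ι → ι → R,
      ∑ r, a r p • ∑ s, b s r • C s = ∑ r, (∑ s, a s p * b r s) • C r := by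
    intro a b
    simp only [smul_sum, sum_smul, mul_smul]
    exact sum_comm
  have key : ∑ r, (k r p • v r A₁ + w r • v r (C p) + (δ₂ (m r p) • C r + m r p • d₂ (C r))
        + m r p • (A₂ * C r) - m r p • (C r * A₂)
        - m r p • v r A₂ - (δ₁ (k r p) • C r + k r p • d₁ (C r))
        - k r p • (A₁ * C r) + k r p • (C r * A₁)
        + (m r p • v r A₂ - m r p • d₂ (C r) - (m r p • (A₂ * C r) - m r p • (C r * A₂))
          + (∑ s, m s p * k r s) • C r)
        - (k r p • v r A₁ - k r p • d₁ (C r) - (k r p • (A₁ * C r) - k r p • (C r * A₁))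
          + (∑ s, k s p * m r s) • C r))
      = ∑ r, (dv p (w r) • C r + w r • v p (C r) + w r • (C p * C r) - w r • (C r * C p)
        + (w r • v r (C p) - w r • v p (C r) + (w r • (C r * C p) - w r • (C p * C r)))) := by
    refine sum_congr rfl fun r _ => ?_
    rw [hw]
    module
  simp only [sum_add_distrib, sum_sub_distrib] at key
  simp only [hP₁, hP₂, hS, hF, map_add, map_sub, map_sum, hd₁, hd₂, hv, hs₁, hs₂, hsv, h₁, h₂, h₂₁,
    mul_add, add_mul, mul_sub, sub_mul, mul_sum, sum_mul, mul_smul_comm, smul_mul_assoc,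
    smul_add, smul_sub, hswap, sum_add_distrib, sum_sub_distrib, mul_assoc] at key ⊢
  rw [← sub_eq_zero] at key ⊢
  rw [← key]
  abel

section Algebra

variable {ι R : Type*} [CommRing R] [Algebra ℝ R]

/-- A derivation of `R` applied entrywise to matrices over `R`. -/
def matDer (d : Derivation ℝ R R) : Matrix ι ι R →+ Matrix ι ι R :=
  (d : R →ₗ[ℝ] R).mapMatrix.toAddMonoidHom

theorem matDer_apply (d : Derivation ℝ R R) (X : Matrix ι ι R) (i j : ι) :
    matDer d X i j = d (X i j) := rfl

theorem matDer_mul [Fintype ι] (d : Derivation ℝ R R) (X Y : Matrix ι ι R) :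
    matDer d (X * Y) = matDer d X * Y + X * matDer d Y := by
  ext i j
  simp only [matDer_apply, Matrix.add_apply, Matrix.mul_apply, map_sum, Derivation.leibniz,
    smul_eq_mul, ← sum_add_distrib]
  exact sum_congr rfl fun r _ => by ring

theorem matDer_smul (d : Derivation ℝ R R) (f : R) (X : Matrix ι ι R) :
    matDer d (f • X) = d f • X + f • matDer d X := by
  ext i j
  simp only [matDer_apply, Matrix.add_apply, Matrix.smul_apply, Derivation.leibniz, smul_eq_mul]
  ring

variable [Fintype ι]

/-- The derivation `D - aʳ vᵣ` adapted to a nonlinear connection with components `a`. -/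
def adapted (D : Derivation ℝ R R) (v : ι → Derivation ℝ R R) (a : ι → R) : Derivation ℝ R R :=
  D - ∑ r, a r • v r

theorem adapted_apply (D : Derivation ℝ R R) (v : ι → Derivation ℝ R R) (a : ι → R) (f : R) :
    adapted D v a f = D f - ∑ r, a r * v r f := by
  have hsum : (∑ r, a r • v r : Derivation ℝ R R) f = ∑ r, a r * v r f := by
    rw [← Derivation.coeFnAddMonoidHom_apply, map_sum, Finset.sum_apply]
    rfl
  rw [adapted, Derivation.sub_apply, hsum]

theorem adapted_vertical_comm {D : Derivation ℝ R R} {v : ι → Derivation ℝ R R} (a : ι → R)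
    (hD : ∀ p f, D (v p f) = v p (D f)) (hv : ∀ p q f, v p (v q f) = v q (v p f)) (p : ι) (f : R) :
    adapted D v a (v p f) = v p (adapted D v a f) + ∑ r, v p (a r) * v r f := by
  simp only [adapted_apply, hD, map_sub, map_sum, Derivation.leibniz, smul_eq_mul,
    sum_add_distrib, hv p]
  simp only [mul_comm]
  ring

theorem adapted_adapted_comm {D₁ D₂ : Derivation ℝ R R} {v : ι → Derivation ℝ R R} (a b : ι → R)
    (hD : ∀ f, D₂ (D₁ f) = D₁ (D₂ f)) (hD₁ : ∀ p f, D₁ (v p f) = v p (D₁ f))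
    (hD₂ : ∀ p f, D₂ (v p f) = v p (D₂ f)) (hv : ∀ p q f, v p (v q f) = v q (v p f)) (f : R) :
    adapted D₂ v b (adapted D₁ v a f) = adapted D₁ v a (adapted D₂ v b f)
      - ∑ r, (adapted D₂ v b (a r) - adapted D₁ v a (b r)) * v r f := by
  have hswap : ∑ r, a r * ∑ s, b s * v s (v r f) = ∑ r, b r * ∑ s, a s * v s (v r f) := by
    simp only [mul_sum]
    rw [sum_comm]
    exact sum_congr rfl fun r _ => sum_congr rfl fun s _ => by rw [hv r s]; ring
  have h₁ : ∀ r, adapted D₁ v a (v r f) = v r (D₁ f) - ∑ s, a s * v s (v r f) := fun r => by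
    rw [adapted_apply, hD₁]
  have h₂ : ∀ r, adapted D₂ v b (v r f) = v r (D₂ f) - ∑ s, b s * v s (v r f) := fun r => by
    rw [adapted_apply, hD₂]
  have h₁₂ := adapted_apply D₁ v a (D₂ f)
  have h₂₁ := adapted_apply D₂ v b (D₁ f)
  rw [adapted_apply D₁ v a f, adapted_apply D₂ v b f]
  simp only [map_sub, map_sum, Derivation.leibniz, smul_eq_mul, sum_add_distrib, h₁, h₂, h₁₂, h₂₁,
    hD, sub_mul, mul_sub, sum_sub_distrib, hswap, mul_comm (v _ f)]
  ring

/-- The curvature with one index along `d` and one vertical index `p`. -/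
def mixedCurv (d : Derivation ℝ R R) (v : ι → Derivation ℝ R R) (a : ι → R) (A : Matrix ι ι R)
    (C : ι → Matrix ι ι R) (p : ι) : Matrix ι ι R :=
  matDer (v p) A - matDer d (C p) - (A * C p - C p * A) + ∑ r, v p (a r) • C r

/-- The vertical curvature. -/
def vertCurv (v : ι → Derivation ℝ R R) (C : ι → Matrix ι ι R) (p q : ι) : Matrix ι ι R :=
  matDer (v q) (C p) - matDer (v p) (C q) + (C q * C p - C p * C q)

/-- The curvature along a pair of adapted derivations `d₁`, `d₂`. -/
def horCurv (d₁ d₂ : Derivation ℝ R R) (a b : ι → R) (A₁ A₂ : Matrix ι ι R)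
    (C : ι → Matrix ι ι R) : Matrix ι ι R :=
  matDer d₂ A₁ - matDer d₁ A₂ + (A₂ * A₁ - A₁ * A₂) + ∑ r, (d₂ (a r) - d₁ (b r)) • C r

theorem bianchi_adapted [DecidableEq ι] {D₁ D₂ : Derivation ℝ R R} {v : ι → Derivation ℝ R R} (a b : ι → R)
    (hD : ∀ f, D₂ (D₁ f) = D₁ (D₂ f)) (hD₁ : ∀ p f, D₁ (v p f) = v p (D₁ f))
    (hD₂ : ∀ p f, D₂ (v p f) = v p (D₂ f)) (hv : ∀ p q f, v p (v q f) = v q (v p f))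
    {d₁ d₂ : Derivation ℝ R R} (hd₁ : d₁ = adapted D₁ v a) (hd₂ : d₂ = adapted D₂ v b)
    (A₁ A₂ : Matrix ι ι R) (C : ι → Matrix ι ι R) (p : ι) :
    matDer d₂ (mixedCurv d₁ v a A₁ C p)
        + (A₂ * mixedCurv d₁ v a A₁ C p - mixedCurv d₁ v a A₁ C p * A₂)
        - (matDer d₁ (mixedCurv d₂ v b A₂ C p)
          + (A₁ * mixedCurv d₂ v b A₂ C p - mixedCurv d₂ v b A₂ C p * A₁))
        + ∑ r, v p (a r) • mixedCurv d₂ v b A₂ C r - ∑ r, v p (b r) • mixedCurv d₁ v a A₁ C r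
      = matDer (v p) (horCurv d₁ d₂ a b A₁ A₂ C)
        + (C p * horCurv d₁ d₂ a b A₁ A₂ C - horCurv d₁ d₂ a b A₁ A₂ C * C p)
        + ∑ r, (d₂ (a r) - d₁ (b r)) • vertCurv v C p r := by
  have hc₁ : ∀ p f, d₁ (v p f) = v p (d₁ f) + ∑ r, v p (a r) * v r f :=
    hd₁ ▸ adapted_vertical_comm a hD₁ hv
  have hc₂ : ∀ p f, d₂ (v p f) = v p (d₂ f) + ∑ r, v p (b r) * v r f :=
    hd₂ ▸ adapted_vertical_comm b hD₂ hv
  have hc₂₁ : ∀ f, d₂ (d₁ f) = d₁ (d₂ f) - ∑ r, (d₂ (a r) - d₁ (b r)) * v r f :=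
    hd₁ ▸ hd₂ ▸ adapted_adapted_comm a b hD hD₁ hD₂ hv
  refine bianchi_algebra d₁ d₂ (fun p => v p) (matDer d₁) (matDer d₂) (fun p => matDer (v p))
    (matDer_mul d₁) (matDer_mul d₂) (fun p => matDer_mul (v p)) (matDer_smul d₁) (matDer_smul d₂)
    (fun p => matDer_smul (v p)) (fun r p => v p (a r)) (fun r p => v p (b r)) _
    ?_ ?_ ?_ ?_ A₁ A₂ C _ _ (vertCurv v C) _ (fun _ => rfl) (fun _ => rfl) (fun _ _ => rfl) rfl p
  · intro p X
    ext i j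
    simp only [matDer_apply, Matrix.add_apply, Matrix.sum_apply, Matrix.smul_apply, smul_eq_mul,
      hc₁]
  · intro p X
    ext i j
    simp only [matDer_apply, Matrix.add_apply, Matrix.sum_apply, Matrix.smul_apply, smul_eq_mul,
      hc₂]
  · intro X
    ext i j
    simp only [matDer_apply, Matrix.sub_apply, Matrix.sum_apply, Matrix.smul_apply, smul_eq_mul,
      hc₂₁]
  · intro p r
    simp only [map_sub, hc₁, hc₂]
    ring

end Algebra

/-- The algebra of smooth functions on the jet space. -/
def smoothFn (n : ℕ) : Subalgebra ℝ (Fn n) where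
  carrier := {F | Smooth F}
  mul_mem' {F G} hF hG := ContDiff.mul (show Smooth F from hF) (show Smooth G from hG)
  add_mem' {F G} hF hG := ContDiff.add (show Smooth F from hF) (show Smooth G from hG)
  algebraMap_mem' c := by
    change Smooth (algebraMap ℝ (Fn n) c)
    unfold Smooth
    exact contDiff_const (c := c)

section Partial

variable {n : ℕ}

/-- A function on the jet space, uncurried. -/
def unc (F : Fn n) (q : ℝ × (Fin n → ℝ) × (Fin n → ℝ)) : ℝ := F q.1 q.2.1 q.2.2

theorem contDiff_unc (F : smoothFn n) : ContDiff ℝ (⊤ : ℕ∞) (unc (F : Fn n)) := by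
  have hF : Smooth (F : Fn n) := F.2
  exact hF

theorem differentiable_unc (F : smoothFn n) : Differentiable ℝ (unc (F : Fn n)) :=
  (contDiff_unc F).differentiable (by simp)

theorem smooth_fderiv_apply (u : ℝ × (Fin n → ℝ) × (Fin n → ℝ)) (F : smoothFn n) :
    Smooth fun t x y => fderiv ℝ (unc (F : Fn n)) (t, x, y) u := by
  unfold Smooth
  exact ((contDiff_unc F).fderiv_right (m := (⊤ : ℕ∞)) (by simp)).clm_apply contDiff_const

/-- The directional derivative along a constant vector, as a derivation of the algebra of
smooth functions. -/
def dirDer (u : ℝ × (Fin n → ℝ) × (Fin n → ℝ)) : Derivation ℝ (smoothFn n) (smoothFn n) :=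
  Derivation.mk'
    { toFun F := ⟨fun t x y => fderiv ℝ (unc (F : Fn n)) (t, x, y) u, smooth_fderiv_apply u F⟩
      map_add' F G := by
        ext t x y
        exact congrArg (· u) (fderiv_add (differentiable_unc F _) (differentiable_unc G _))
      map_smul' c F := by
        ext t x y
        exact congrArg (· u) (fderiv_const_smul (differentiable_unc F _) c) }
    fun F G => by
      ext t x y
      exact congrArg (· u) (fderiv_mul (differentiable_unc F _) (differentiable_unc G _))

theorem dirDer_apply (u : ℝ × (Fin n → ℝ) × (Fin n → ℝ)) (F : smoothFn n) (t : ℝ)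
    (x y : Fin n → ℝ) :
    (dirDer u F : Fn n) t x y = fderiv ℝ (unc (F : Fn n)) (t, x, y) u := rfl

theorem dirDer_comm (u w : ℝ × (Fin n → ℝ) × (Fin n → ℝ)) (F : smoothFn n) :
    dirDer u (dirDer w F) = dirDer w (dirDer u F) := by
  ext t x y
  have hd : DifferentiableAt ℝ (fderiv ℝ (unc (F : Fn n))) (t, x, y) :=
    ((contDiff_unc F).fderiv_right (m := 1) (by norm_cast)).differentiable (by simp) _
  have key : ∀ a b, (dirDer a (dirDer b F) : Fn n) t x y
      = fderiv ℝ (fderiv ℝ (unc (F : Fn n))) (t, x, y) a b := by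
    intro a b
    refine (dirDer_apply a (dirDer b F) t x y).trans ?_
    refine (congrArg (· a) (fderiv_clm_apply hd (differentiableAt_const b))).trans ?_
    simp
  rw [key, key]
  exact ((contDiff_unc F).contDiffAt.isSymmSndFDerivAt (by simpa using by norm_cast)).eq u w

theorem pt_eq_dirDer (F : smoothFn n) : pt (F : Fn n) = dirDer (1, 0, 0) F := by
  funext t x y
  have hg : HasDerivAt (fun s : ℝ => (s, x, y)) ((1, 0, 0) : ℝ × (Fin n → ℝ) × (Fin n → ℝ)) t :=
    (hasDerivAt_id t).prodMk (hasDerivAt_const t (x, y))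
  exact ((differentiable_unc F (t, x, y)).hasFDerivAt.comp_hasDerivAt t hg).deriv

theorem px_eq_dirDer (i : Fin n) (F : smoothFn n) :
    px i (F : Fn n) = dirDer (0, Pi.single i 1, 0) F := by
  funext t x y
  have hg : HasDerivAt (fun s : ℝ => (t, Function.update x i s, y))
      ((0, Pi.single i 1, 0) : ℝ × (Fin n → ℝ) × (Fin n → ℝ)) (x i) :=
    (hasDerivAt_const _ t).prodMk ((hasDerivAt_update x i (x i)).prodMk (hasDerivAt_const _ y))
  have hF := (differentiable_unc F (t, Function.update x i (x i), y)).hasFDerivAt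
  refine (hF.comp_hasDerivAt (x i) hg).deriv.trans ?_
  rw [Function.update_eq_self, dirDer_apply]

/-- The vertical coordinate derivations. -/
def vertDer (i : Fin n) : Derivation ℝ (smoothFn n) (smoothFn n) := dirDer (0, 0, Pi.single i 1)

theorem py_eq_vertDer (i : Fin n) (F : smoothFn n) : py i (F : Fn n) = vertDer i F := by
  funext t x y
  have hg : HasDerivAt (fun s : ℝ => (t, x, Function.update y i s))
      ((0, 0, Pi.single i 1) : ℝ × (Fin n → ℝ) × (Fin n → ℝ)) (y i) :=
    (hasDerivAt_const _ t).prodMk ((hasDerivAt_const _ x).prodMk (hasDerivAt_update y i (y i)))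
  have hF := (differentiable_unc F (t, x, Function.update y i (y i))).hasFDerivAt
  refine (hF.comp_hasDerivAt (y i) hg).deriv.trans ?_
  rw [Function.update_eq_self, vertDer, dirDer_apply]

end Partial

section Connection

variable {n : ℕ}

/-- The derivation `δ/δt`. -/
def dtDer (M : Fin n → smoothFn n) : Derivation ℝ (smoothFn n) (smoothFn n) :=
  adapted (dirDer (1, 0, 0)) vertDer M

/-- The derivation `δ/δxᵏ`. -/
def dxDer (N : Fin n → Fin n → smoothFn n) (k : Fin n) :
    Derivation ℝ (smoothFn n) (smoothFn n) :=
  adapted (dirDer (0, Pi.single k 1, 0)) vertDer fun r => N r k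

theorem dt_eq_dtDer (M : Fin n → smoothFn n) (F : smoothFn n) :
    dt (fun i => (M i : Fn n)) F = dtDer M F := by
  simp only [dt, dtDer, adapted_apply, pt_eq_dirDer, py_eq_vertDer]
  push_cast
  rfl

theorem dx_eq_dxDer (N : Fin n → Fin n → smoothFn n) (k : Fin n) (F : smoothFn n) :
    dx (fun i j => (N i j : Fn n)) k F = dxDer N k F := by
  simp only [dx, dxDer, adapted_apply, px_eq_dirDer, py_eq_vertDer]
  push_cast
  rfl

/-- The connection with the given smooth coefficients. -/
def ofSmooth (κ : Fn n) (G : Fin n → Fin n → smoothFn n) (L C : Fin n → Fin n → Fin n → smoothFn n) :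
    Conn n where
  κ := κ
  G k i := G k i
  L k i j := L k i j
  C k i j := C k i j

/-- The matrix obtained from three-index coefficients by fixing the last index. -/
def slice (L : Fin n → Fin n → Fin n → smoothFn n) (k : Fin n) :
    Matrix (Fin n) (Fin n) (smoothFn n) :=
  Matrix.of fun l i => L l i k

variable (κ : Fn n) (M : Fin n → smoothFn n) (N : Fin n → Fin n → smoothFn n)
  (G : Fin n → Fin n → smoothFn n) (L C : Fin n → Fin n → Fin n → smoothFn n)

theorem Sc_eq_vertCurv (l i p q : Fin n) :
    Sc (ofSmooth κ G L C) l i p q = vertCurv vertDer (slice C) p q l i := by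
  simp only [Sc, ofSmooth, vertCurv, Matrix.add_apply, Matrix.sub_apply, Matrix.mul_apply,
    matDer_apply, slice, Matrix.of_apply, py_eq_vertDer]
  push_cast
  simp only [mul_comm]
  abel

theorem Rc1_eq_horCurv (l i k : Fin n) :
    Rc1 (fun i => (M i : Fn n)) (fun i j => (N i j : Fn n)) (ofSmooth κ G L C) l i k
      = horCurv (dtDer M) (dxDer N k) M (fun r => N r k) (Matrix.of G) (slice L k) (slice C) l i := by
  simp only [Rc1, Rv1, ofSmooth, horCurv, Matrix.add_apply, Matrix.sub_apply, Matrix.mul_apply,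
    Matrix.sum_apply, Matrix.smul_apply, smul_eq_mul,
    matDer_apply, slice, Matrix.of_apply, dt_eq_dtDer, dx_eq_dxDer]
  push_cast
  simp only [mul_comm]
  abel

theorem Rc_eq_horCurv (l i j k : Fin n) :
    Rc (fun i => (M i : Fn n)) (fun i j => (N i j : Fn n)) (ofSmooth κ G L C) l i j k
      = horCurv (dxDer N j) (dxDer N k) (fun r => N r j) (fun r => N r k) (slice L j) (slice L k)
          (slice C) l i := by
  simp only [Rc, Rvsp, ofSmooth, horCurv, Matrix.add_apply, Matrix.sub_apply, Matrix.mul_apply,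
    Matrix.sum_apply, Matrix.smul_apply, smul_eq_mul,
    matDer_apply, slice, Matrix.of_apply, dx_eq_dxDer]
  push_cast
  simp only [mul_comm]
  abel

theorem Pc1_eq_mixedCurv (l i p : Fin n) :
    Pc1 (fun i => (M i : Fn n)) (fun i j => (N i j : Fn n)) (ofSmooth κ G L C) l i p
      = mixedCurv (dtDer M) vertDer M (Matrix.of G) (slice C) p l i := by
  simp [Pc1, covT, CT, sigC, Fin.sum_univ_three, Pv1, ofSmooth, mixedCurv, Matrix.mul_apply,
    Matrix.sum_apply, matDer_apply, slice, dt_eq_dtDer, py_eq_vertDer]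
  simp only [mul_comm, mul_sub, mul_add, sum_add_distrib, sum_sub_distrib]
  abel

theorem Pc_eq_mixedCurv (l i j p : Fin n) :
    Pc (fun i => (M i : Fn n)) (fun i j => (N i j : Fn n)) (ofSmooth κ G L C) l i j p
      = mixedCurv (dxDer N j) vertDer (fun r => N r j) (slice L j) (slice C) p l i := by
  simp [Pc, covX, CT, sigC, Fin.sum_univ_three, Pvsp, ofSmooth, mixedCurv, Matrix.mul_apply,
    Matrix.sum_apply, matDer_apply, slice, dx_eq_dxDer, py_eq_vertDer]
  simp only [mul_comm, mul_sub, sum_sub_distrib]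
  abel

theorem bianchi_temporal {M₀ : Fin n → Fn n} {N₀ : Fin n → Fin n → Fn n} {Γ : Conn n}
    (hM : M₀ = fun i => (M i : Fn n)) (hN : N₀ = fun i j => (N i j : Fn n))
    (hΓ : Γ = ofSmooth κ G L C) (l i k p : Fin n) :
    dx N₀ k (Pc1 M₀ N₀ Γ l i p)
        + ((∑ r, Γ.L l r k * Pc1 M₀ N₀ Γ r i p) - ∑ r, Pc1 M₀ N₀ Γ l r p * Γ.L r i k)
        - (dt M₀ (Pc M₀ N₀ Γ l i k p)
          + ((∑ r, Γ.G l r * Pc M₀ N₀ Γ r i k p) - ∑ r, Pc M₀ N₀ Γ l r k p * Γ.G r i))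
        + (∑ r, py p (M₀ r) * Pc M₀ N₀ Γ l i k r) - (∑ r, py p (N₀ r k) * Pc1 M₀ N₀ Γ l i r)
      = py p (Rc1 M₀ N₀ Γ l i k)
        + ((∑ r, Γ.C l r p * Rc1 M₀ N₀ Γ r i k) - ∑ r, Rc1 M₀ N₀ Γ l r k * Γ.C r i p)
        + ∑ r, Rv1 M₀ N₀ r k * Sc Γ l i p r := by
  subst hM hN hΓ
  have key := congrArg
    (fun X : Matrix (Fin n) (Fin n) (smoothFn n) => ((X l i : smoothFn n) : Fn n))
    (bianchi_adapted M (fun r => N r k) (dirDer_comm _ _) (fun _ => dirDer_comm _ _)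
      (fun _ => dirDer_comm _ _) (fun _ _ => dirDer_comm _ _) (v := vertDer)
      (d₁ := dtDer M) (d₂ := dxDer N k)
      rfl rfl (Matrix.of G) (slice L k) (slice C) p)
  simp only [Matrix.add_apply, Matrix.sub_apply, Matrix.mul_apply, Matrix.sum_apply,
    Matrix.smul_apply, smul_eq_mul, matDer_apply] at key
  push_cast at key
  simp only [← Sc_eq_vertCurv κ G L C, ← Pc_eq_mixedCurv κ M N G L C,
    ← Pc1_eq_mixedCurv κ M N G L C, ← Rc1_eq_horCurv κ M N G L C, ← dt_eq_dtDer, ← dx_eq_dxDer,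
    ← py_eq_vertDer] at key
  exact key

theorem bianchi_spatial {M₀ : Fin n → Fn n} {N₀ : Fin n → Fin n → Fn n} {Γ : Conn n}
    (hM : M₀ = fun i => (M i : Fn n)) (hN : N₀ = fun i j => (N i j : Fn n))
    (hΓ : Γ = ofSmooth κ G L C) (l i j k p : Fin n) :
    dx N₀ k (Pc M₀ N₀ Γ l i j p)
        + ((∑ r, Γ.L l r k * Pc M₀ N₀ Γ r i j p) - ∑ r, Pc M₀ N₀ Γ l r j p * Γ.L r i k)
        - (dx N₀ j (Pc M₀ N₀ Γ l i k p)
          + ((∑ r, Γ.L l r j * Pc M₀ N₀ Γ r i k p) - ∑ r, Pc M₀ N₀ Γ l r k p * Γ.L r i j))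
        + (∑ r, py p (N₀ r j) * Pc M₀ N₀ Γ l i k r) - (∑ r, py p (N₀ r k) * Pc M₀ N₀ Γ l i j r)
      = py p (Rc M₀ N₀ Γ l i j k)
        + ((∑ r, Γ.C l r p * Rc M₀ N₀ Γ r i j k) - ∑ r, Rc M₀ N₀ Γ l r j k * Γ.C r i p)
        + ∑ r, Rvsp M₀ N₀ r j k * Sc Γ l i p r := by
  subst hM hN hΓ
  have key := congrArg
    (fun X : Matrix (Fin n) (Fin n) (smoothFn n) => ((X l i : smoothFn n) : Fn n))
    (bianchi_adapted (fun r => N r j) (fun r => N r k) (dirDer_comm _ _) (fun _ => dirDer_comm _ _)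
      (fun _ => dirDer_comm _ _) (fun _ _ => dirDer_comm _ _) (v := vertDer)
      (d₁ := dxDer N j) (d₂ := dxDer N k)
      rfl rfl (slice L j) (slice L k) (slice C) p)
  simp only [Matrix.add_apply, Matrix.sub_apply, Matrix.mul_apply, Matrix.sum_apply,
    Matrix.smul_apply, smul_eq_mul, matDer_apply] at key
  push_cast at key
  simp only [← Sc_eq_vertCurv κ G L C, ← Pc_eq_mixedCurv κ M N G L C,
    ← Rc_eq_horCurv κ M N G L C, ← dx_eq_dxDer, ← py_eq_vertDer] at key
  exact key

theorem Rc_antisymm (M : Fin n → Fn n) (N : Fin n → Fin n → Fn n) (Γ : Conn n) (l i j k : Fin n) :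
    Rc M N Γ l i j k = -Rc M N Γ l i k j := by
  simp only [Rc, Rvsp, mul_sub, sum_sub_distrib]
  abel

end Connection

/-- local Bianchi identities for an h-normal Γ-linear connection
of Cartan type. -/
theorem bianchi_identities_15_16
    (n : ℕ) (hn : 1 ≤ n)
    (h : ℝ → ℝ) (hh : ContDiff ℝ (⊤ : ℕ∞) h) (hhpos : ∀ t, 0 < h t)
    (M : Fin n → Fn n) (N : Fin n → Fin n → Fn n) (Γ : Conn n)
    (hκ : Γ.κ = chr h)
    (hMs : ∀ i, Smooth (M i)) (hNs : ∀ i j, Smooth (N i j))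
    (hGs : ∀ k i, Smooth (Γ.G k i)) (hLs : ∀ k i j, Smooth (Γ.L k i j))
    (hCs : ∀ k i j, Smooth (Γ.C k i j))
    (hLsym : ∀ k i j, Γ.L k i j = Γ.L k j i) (hCsym : ∀ k i j, Γ.C k i j = Γ.C k j i) :
    (∀ l i k p,
      covX N Γ sigPc1 k (Pc1T M N Γ) ![l, i, p]
        - covT M Γ 0 sigPc (PcT M N Γ) ![l, i, k, p]
        + (∑ r, Pv1 M Γ r p * Pc M N Γ l i k r)
        - (∑ r, Pvsp N Γ r k p * Pc1 M N Γ l i r)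
      = covY Γ sigRc1 p (Rc1T M N Γ) ![l, i, k]
        + (∑ r, Rv1 M N r k * Sc Γ l i p r)
        + (∑ r, Γ.C r k p * Rc1 M N Γ l i r)
        - (∑ r, T1 Γ r k * Pc M N Γ l i r p))
    ∧ (∀ l i j k p,
      (((∑ r, Rc M N Γ l i j r * Γ.C r k p)
          + (∑ r, Pc M N Γ l i j r * Pvsp N Γ r k p)
          + covX N Γ sigPc j (PcT M N Γ) ![l, i, k, p])
        - ((∑ r, Rc M N Γ l i k r * Γ.C r j p)
          + (∑ r, Pc M N Γ l i k r * Pvsp N Γ r j p)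
          + covX N Γ sigPc k (PcT M N Γ) ![l, i, j, p]))
      = -(∑ r, Sc Γ l i p r * Rvsp M N r j k)
        - covY Γ sigRc p (RcT M N Γ) ![l, i, j, k]) := by
  let M' : Fin n → smoothFn n := fun i => ⟨M i, hMs i⟩
  let N' : Fin n → Fin n → smoothFn n := fun i j => ⟨N i j, hNs i j⟩
  let G' : Fin n → Fin n → smoothFn n := fun i j => ⟨Γ.G i j, hGs i j⟩
  let L' : Fin n → Fin n → Fin n → smoothFn n := fun k i j => ⟨Γ.L k i j, hLs k i j⟩
  let C' : Fin n → Fin n → Fin n → smoothFn n := fun k i j => ⟨Γ.C k i j, hCs k i j⟩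
  constructor
  · intro l i k p
    have key := bianchi_temporal Γ.κ M' N' G' L' C' (M₀ := M) (N₀ := N) (Γ := Γ)
      rfl rfl rfl l i k p
    simp [covX, covT, covY, Pc1T, PcT, Rc1T, sigPc1, sigPc, sigRc1, Fin.sum_univ_three,
      Fin.sum_univ_four, Pv1, Pvsp, T1]
    simp only [mul_add, mul_sub, sum_add_distrib, sum_sub_distrib, mul_comm]
      at key ⊢
    rw [← sub_eq_zero] at key ⊢
    rw [← key]
    abel
  · intro l i j k p
    have key := bianchi_spatial Γ.κ M' N' G' L' C' (M₀ := M) (N₀ := N) (Γ := Γ)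
      rfl rfl rfl l i j k p
    simp [covX, covY, PcT, RcT, sigPc, sigRc, Fin.sum_univ_four, Pvsp,
      Rc_antisymm M N Γ l i k]
    simp only [hLsym _ k j, mul_sub, sum_sub_distrib,
      mul_comm] at key ⊢
    rw [← sub_eq_zero] at key ⊢
    rw [← neg_eq_zero, ← key]
    abel

end Jet
end
end

section
/- For every h-normal Γ-linear connection of Cartan type, the following local Bianchi identity holds for all indices l, i, j, k, p: (19) Σ_{i,j,k} (S^l_p(i)(j))|_(k) = 0. -/
open Finset

noncomputable section

namespace Jet

/-- `F` as a function of the single variable `(t, x, y)`. -/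
def uncurried {n : ℕ} (F : Fn n) : ℝ × (Fin n → ℝ) × (Fin n → ℝ) → ℝ :=
  fun p => F p.1 p.2.1 p.2.2

/-- The direction of the coordinate `yⁱ`. -/
def ydir {n : ℕ} (i : Fin n) : ℝ × (Fin n → ℝ) × (Fin n → ℝ) := (0, 0, Pi.single i 1)

section Derivatives

variable {n : ℕ} {F H : Fn n}

theorem Smooth.differentiable (hF : Smooth F) : Differentiable ℝ (uncurried F) :=
  ContDiff.differentiable (n := (⊤ : ℕ∞)) hF (by simp)

theorem Smooth.hasDerivAt_update (hF : Smooth F) (i : Fin n) (t : ℝ) (x y : Fin n → ℝ) :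
    HasDerivAt (fun s => F t x (Function.update y i s))
      (fderiv ℝ (uncurried F) (t, x, y) (ydir i)) (y i) := by
  have hγ : HasDerivAt (fun s => (t, x, Function.update y i s)) (ydir i) (y i) :=
    (hasDerivAt_const _ _).prodMk ((hasDerivAt_const _ _).prodMk (_root_.hasDerivAt_update y i _))
  have hf : HasFDerivAt (uncurried F) (fderiv ℝ (uncurried F) (t, x, y))
      (t, x, Function.update y i (y i)) := by
    rw [Function.update_eq_self]
    exact (hF.differentiable _).hasFDerivAt
  exact hf.comp_hasDerivAt (y i) hγ

theorem Smooth.py_apply (hF : Smooth F) (i : Fin n) (t : ℝ) (x y : Fin n → ℝ) :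
    py i F t x y = fderiv ℝ (uncurried F) (t, x, y) (ydir i) :=
  (hF.hasDerivAt_update i t x y).deriv

theorem Smooth.hasDerivAt_py (hF : Smooth F) (i : Fin n) (t : ℝ) (x y : Fin n → ℝ) :
    HasDerivAt (fun s => F t x (Function.update y i s)) (py i F t x y) (y i) := by
  rw [hF.py_apply]
  exact hF.hasDerivAt_update i t x y

theorem Smooth.uncurried_py (hF : Smooth F) (i : Fin n) :
    uncurried (py i F) = fun p => fderiv ℝ (uncurried F) p (ydir i) :=
  funext fun p => hF.py_apply i p.1 p.2.1 p.2.2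

theorem Smooth.add (hF : Smooth F) (hH : Smooth H) : Smooth (F + H) := ContDiff.add hF hH

theorem Smooth.sub (hF : Smooth F) (hH : Smooth H) : Smooth (F - H) := ContDiff.sub hF hH

theorem Smooth.mul (hF : Smooth F) (hH : Smooth H) : Smooth (F * H) := ContDiff.mul hF hH

theorem Smooth.sum {ι : Type*} {s : Finset ι} {F : ι → Fn n} (hF : ∀ r, Smooth (F r)) :
    Smooth (∑ r ∈ s, F r) := by
  simp only [Smooth, Finset.sum_apply]
  exact ContDiff.sum fun r _ => hF r

theorem Smooth.py (hF : Smooth F) (i : Fin n) : Smooth (py i F) := by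
  change ContDiff ℝ _ (uncurried (Jet.py i F))
  rw [hF.uncurried_py]
  exact (ContDiff.fderiv_right (m := (⊤ : ℕ∞)) (n := (⊤ : ℕ∞)) hF (by simp)).clm_apply
    contDiff_const

theorem py_add (hF : Smooth F) (hH : Smooth H) (i : Fin n) :
    py i (F + H) = py i F + py i H := by
  funext t x y
  exact ((hF.hasDerivAt_py i t x y).add (hH.hasDerivAt_py i t x y)).deriv

theorem py_sub (hF : Smooth F) (hH : Smooth H) (i : Fin n) :
    py i (F - H) = py i F - py i H := by
  funext t x y
  exact ((hF.hasDerivAt_py i t x y).sub (hH.hasDerivAt_py i t x y)).deriv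

theorem py_mul (hF : Smooth F) (hH : Smooth H) (i : Fin n) :
    py i (F * H) = py i F * H + F * py i H := by
  funext t x y
  refine ((hF.hasDerivAt_py i t x y).mul (hH.hasDerivAt_py i t x y)).deriv.trans ?_
  simp

theorem py_sum {ι : Type*} {s : Finset ι} {F : ι → Fn n} (hF : ∀ r, Smooth (F r)) (i : Fin n) :
    py i (∑ r ∈ s, F r) = ∑ r ∈ s, py i (F r) := by
  funext t x y
  simp only [Finset.sum_apply]
  rw [← (HasDerivAt.fun_sum fun r (_ : r ∈ s) => (hF r).hasDerivAt_py i t x y).deriv]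
  simp only [py, Finset.sum_apply]

theorem py_comm (hF : Smooth F) (i j : Fin n) : py i (py j F) = py j (py i F) := by
  have hd : Differentiable ℝ (fderiv ℝ (uncurried F)) :=
    (ContDiff.fderiv_right (m := 1) (n := (⊤ : ℕ∞)) hF
      (WithTop.coe_le_coe.2 le_top)).differentiable (by simp)
  have key (i j : Fin n) (t : ℝ) (x y : Fin n → ℝ) : py i (py j F) t x y =
      fderiv ℝ (fderiv ℝ (uncurried F)) (t, x, y) (ydir i) (ydir j) := by
    rw [(hF.py j).py_apply, hF.uncurried_py,
      fderiv_clm_apply (hd _) (differentiableAt_const _)]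
    simp
  funext t x y
  rw [key, key]
  exact ((ContDiff.contDiffAt hF).isSymmSndFDerivAt
    (by simpa using WithTop.coe_le_coe.2 (le_top : (2 : ℕ∞) ≤ ⊤))).eq _ _

end Derivatives

section Matrices

variable {n : ℕ}

/-- The fibre derivative of a matrix of functions, taken entrywise. -/
def pyMat (k : Fin n) (A : Matrix (Fin n) (Fin n) (Fn n)) : Matrix (Fin n) (Fin n) (Fn n) :=
  A.map (py k)

theorem pyMat_add {A B : Matrix (Fin n) (Fin n) (Fn n)} (hA : ∀ l p, Smooth (A l p))
    (hB : ∀ l p, Smooth (B l p)) (k : Fin n) : pyMat k (A + B) = pyMat k A + pyMat k B :=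
  Matrix.ext fun l p => py_add (hA l p) (hB l p) k

theorem pyMat_sub {A B : Matrix (Fin n) (Fin n) (Fn n)} (hA : ∀ l p, Smooth (A l p))
    (hB : ∀ l p, Smooth (B l p)) (k : Fin n) : pyMat k (A - B) = pyMat k A - pyMat k B :=
  Matrix.ext fun l p => py_sub (hA l p) (hB l p) k

theorem smooth_matrix_mul {A B : Matrix (Fin n) (Fin n) (Fn n)} (hA : ∀ l p, Smooth (A l p))
    (hB : ∀ l p, Smooth (B l p)) (l p : Fin n) : Smooth ((A * B) l p) := by
  rw [Matrix.mul_apply]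
  exact Smooth.sum fun r => (hA l r).mul (hB r p)

theorem pyMat_mul {A B : Matrix (Fin n) (Fin n) (Fn n)} (hA : ∀ l p, Smooth (A l p))
    (hB : ∀ l p, Smooth (B l p)) (k : Fin n) :
    pyMat k (A * B) = pyMat k A * B + A * pyMat k B := by
  ext1 l p
  simp only [pyMat, Matrix.map_apply, Matrix.add_apply, Matrix.mul_apply]
  rw [py_sum fun r => (hA l r).mul (hB r p), ← Finset.sum_add_distrib]
  exact Finset.sum_congr rfl fun r _ => py_mul (hA l r) (hB r p) k

theorem pyMat_comm {A : Matrix (Fin n) (Fin n) (Fn n)} (hA : ∀ l p, Smooth (A l p))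
    (i j : Fin n) : pyMat i (pyMat j A) = pyMat j (pyMat i A) :=
  Matrix.ext fun l p => py_comm (hA l p) i j

/-- The matrix `(Cˡₚₖ)` with upper index `l` and lower spatial index `p`. -/
def CMat (Γ : Conn n) (k : Fin n) : Matrix (Fin n) (Fin n) (Fn n) := fun l p => Γ.C l p k

/-- The matrix `(Sˡₚ₍ⱼ₎₍ₖ₎)` with upper index `l` and lower spatial index `p`. -/
def ScMat (Γ : Conn n) (j k : Fin n) : Matrix (Fin n) (Fin n) (Fn n) := fun l p => Sc Γ l p j k

theorem ScMat_eq (Γ : Conn n) (j k : Fin n) :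
    ScMat Γ j k = pyMat k (CMat Γ j) - pyMat j (CMat Γ k)
      + CMat Γ k * CMat Γ j - CMat Γ j * CMat Γ k := by
  ext1 l p
  simp only [Matrix.sub_apply, Matrix.add_apply, Matrix.mul_apply, pyMat, Matrix.map_apply,
    ScMat, CMat, Sc, mul_comm]

theorem Sc_antisymm (Γ : Conn n) (l p i j : Fin n) : Sc Γ l p i j = -Sc Γ l p j i := by
  simp only [Sc]
  abel

theorem pyMat_ScMat (Γ : Conn n) (hC : ∀ k i j, Smooth (Γ.C k i j)) (i j k : Fin n) :
    pyMat k (ScMat Γ i j) =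
      pyMat k (pyMat j (CMat Γ i)) - pyMat k (pyMat i (CMat Γ j))
        + (pyMat k (CMat Γ j) * CMat Γ i + CMat Γ j * pyMat k (CMat Γ i))
        - (pyMat k (CMat Γ i) * CMat Γ j + CMat Γ i * pyMat k (CMat Γ j)) := by
  have hM (k l p : Fin n) : Smooth (CMat Γ k l p) := hC l p k
  have hD (j k l p : Fin n) : Smooth (pyMat j (CMat Γ k) l p) := (hM k l p).py j
  have hP (j k l p : Fin n) := smooth_matrix_mul (hM j) (hM k) l p
  have hDsub (l p : Fin n) : Smooth ((pyMat j (CMat Γ i) - pyMat i (CMat Γ j)) l p) :=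
    (hD j i l p).sub (hD i j l p)
  have hDP (l p : Fin n) :
      Smooth ((pyMat j (CMat Γ i) - pyMat i (CMat Γ j) + CMat Γ j * CMat Γ i) l p) :=
    (hDsub l p).add (hP j i l p)
  rw [ScMat_eq, pyMat_sub hDP (hP _ _), pyMat_add hDsub (hP _ _), pyMat_sub (hD _ _) (hD _ _),
    pyMat_mul (hM _) (hM _), pyMat_mul (hM _) (hM _)]

/-- The second Bianchi identity for the matrix-valued form `C` in the fibre variables. -/
theorem ScMat_bianchi (Γ : Conn n) (hC : ∀ k i j, Smooth (Γ.C k i j)) (i j k : Fin n) :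
    (pyMat k (ScMat Γ i j) + CMat Γ k * ScMat Γ i j - ScMat Γ i j * CMat Γ k)
      + (pyMat i (ScMat Γ j k) + CMat Γ i * ScMat Γ j k - ScMat Γ j k * CMat Γ i)
      + (pyMat j (ScMat Γ k i) + CMat Γ j * ScMat Γ k i - ScMat Γ k i * CMat Γ j) = 0 := by
  have hM (k l p : Fin n) : Smooth (CMat Γ k l p) := hC l p k
  rw [pyMat_ScMat Γ hC, pyMat_ScMat Γ hC, pyMat_ScMat Γ hC, ScMat_eq, ScMat_eq, ScMat_eq,
    pyMat_comm (hM i) k j, pyMat_comm (hM j) k i, pyMat_comm (hM k) j i]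
  noncomm_ring

theorem covY_ScT (Γ : Conn n) (l p i j k : Fin n) :
    covY Γ sigSc k (ScT Γ) ![l, p, i, j] =
      (pyMat k (ScMat Γ i j) + CMat Γ k * ScMat Γ i j - ScMat Γ i j * CMat Γ k) l p
        - ∑ r, Sc Γ l p r j * Γ.C r i k - ∑ r, Sc Γ l p i r * Γ.C r j k := by
  have h0 (r : Fin n) : Function.update ![l, p, i, j] 0 r = ![r, p, i, j] := by
    ext q; fin_cases q <;> rfl
  have h1 (r : Fin n) : Function.update ![l, p, i, j] 1 r = ![l, r, i, j] := by
    ext q; fin_cases q <;> rfl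
  have h2 (r : Fin n) : Function.update ![l, p, i, j] 2 r = ![l, p, r, j] := by
    ext q; fin_cases q <;> rfl
  have h3 (r : Fin n) : Function.update ![l, p, i, j] 3 r = ![l, p, i, r] := by
    ext q; fin_cases q <;> rfl
  have hS (a b c d : Fin n) : ScT Γ ![a, b, c, d] = Sc Γ a b c d := rfl
  have hL : (CMat Γ k * ScMat Γ i j) l p = ∑ r, Sc Γ r p i j * Γ.C l r k := by
    rw [Matrix.mul_apply]
    exact Finset.sum_congr rfl fun r _ => mul_comm _ _
  have hR : (ScMat Γ i j * CMat Γ k) l p = ∑ r, Sc Γ l r i j * Γ.C r p k := Matrix.mul_apply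
  rw [Matrix.sub_apply, Matrix.add_apply, hL, hR]
  simp only [covY, Fin.sum_univ_four, h0, h1, h2, h3, hS]
  change py k (Sc Γ l p i j) + (∑ r, Sc Γ r p i j * Γ.C l r k + -∑ r, Sc Γ l r i j * Γ.C r p k
    + -∑ r, Sc Γ l p r j * Γ.C r i k + -∑ r, Sc Γ l p i r * Γ.C r j k) =
    py k (Sc Γ l p i j) + _ - _ - _ - _
  abel

end Matrices

/-- local Bianchi identities for an h-normal Γ-linear connection
of Cartan type. -/
theorem bianchi_identity_19
    (n : ℕ) (hn : 1 ≤ n)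
    (h : ℝ → ℝ) (hh : ContDiff ℝ (⊤ : ℕ∞) h) (hhpos : ∀ t, 0 < h t)
    (M : Fin n → Fn n) (N : Fin n → Fin n → Fn n) (Γ : Conn n)
    (hκ : Γ.κ = chr h)
    (hMs : ∀ i, Smooth (M i)) (hNs : ∀ i j, Smooth (N i j))
    (hGs : ∀ k i, Smooth (Γ.G k i)) (hLs : ∀ k i j, Smooth (Γ.L k i j))
    (hCs : ∀ k i j, Smooth (Γ.C k i j))
    (hLsym : ∀ k i j, Γ.L k i j = Γ.L k j i) (hCsym : ∀ k i j, Γ.C k i j = Γ.C k j i) :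
    ∀ l p i j k,
      covY Γ sigSc k (ScT Γ) ![l, p, i, j]
        + covY Γ sigSc i (ScT Γ) ![l, p, j, k]
        + covY Γ sigSc j (ScT Γ) ![l, p, k, i] = 0 := by
  intro l p i j k
  have hB := congrFun (congrFun (ScMat_bianchi Γ hCs i j k) l) p
  have hV (a b c : Fin n) :
      ∑ r, Sc Γ l p a r * Γ.C r b c = -∑ r, Sc Γ l p r a * Γ.C r c b := by
    rw [← Finset.sum_neg_distrib]
    refine Finset.sum_congr rfl fun r _ => ?_
    rw [Sc_antisymm, hCsym r b c, neg_mul]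
  simp only [Matrix.add_apply _ _ l p, Matrix.zero_apply] at hB
  rw [covY_ScT, covY_ScT, covY_ScT, hV i j k, hV j k i, hV k i j]
  rw [← hB]
  simp only [Matrix.add_apply, Matrix.sub_apply]
  abel

end Jet
end
end

section
/- For the Berwald connection attached to the pair of Riemannian metrics (h, φ), endowed with the canonical nonlinear connection M^i = −κ y^i, N^i_j = γ^i_jm y^m, all torsion d-tensors vanish identically — T^r_1j = 0, Rv^r_1j = 0, T^r_ij = 0, Pv^r_1j = 0, Ph^r_ij = 0, Pv^r_ij = 0, S^r_ij = 0 — except Rv^k_ij, which equals r^k_mij y^m, where r^k_mij is the curvature tensor of the Christoffel symbols γ of φ. -/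
open Finset

noncomputable section

namespace Jet

variable {n : ℕ}

/-- Partial derivative in `xⁱ` of a function of the spatial variables only. -/
def pxn (i : Fin n) (f : (Fin n → ℝ) → ℝ) : (Fin n → ℝ) → ℝ :=
  fun x => deriv (fun s => f (Function.update x i s)) (x i)

/-- Lift a function of the spatial variables to the jet space. -/
def liftX (f : (Fin n → ℝ) → ℝ) : Fn n := fun _ x _ => f x

/-- The Christoffel symbols `γⁱⱼₖ = (φⁱᵐ/2)(∂φⱼₘ/∂xᵏ + ∂φₖₘ/∂xʲ − ∂φⱼₖ/∂xᵐ)`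
of a Riemannian metric `φ` with inverse `φinv`. -/
def gam (φ φinv : (Fin n → ℝ) → Fin n → Fin n → ℝ) (i j k : Fin n) :
    (Fin n → ℝ) → ℝ :=
  fun x => ∑ m, φinv x i m / 2 *
    (pxn k (fun z => φ z j m) x + pxn j (fun z => φ z k m) x
      - pxn m (fun z => φ z j k) x)

/-- The curvature tensor `rˡᵢⱼₖ` of the Christoffel symbols `γ` of `φ`. -/
def rphi (φ φinv : (Fin n → ℝ) → Fin n → Fin n → ℝ) (l i j k : Fin n) :
    (Fin n → ℝ) → ℝ :=
  fun x => pxn k (gam φ φinv l i j) x - pxn j (gam φ φinv l i k) x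
    + (∑ r, gam φ φinv r i j x * gam φ φinv l r k x)
    - ∑ r, gam φ φinv r i k x * gam φ φinv l r j x

/-- The temporal coefficients `Mⁱ = −κ yⁱ` of the canonical nonlinear connection. -/
def MB (h : ℝ → ℝ) : Fin n → Fn n := fun i => -(chr h * yc i)

/-- The spatial coefficients `Nⁱⱼ = γⁱⱼₘ yᵐ` of the canonical nonlinear connection. -/
def NB (φ φinv : (Fin n → ℝ) → Fin n → Fin n → ℝ) : Fin n → Fin n → Fn n :=
  fun i j => ∑ m, liftX (gam φ φinv i j m) * yc m

/-- The Berwald connection `(κ, 0, γᵏᵢⱼ, 0)` attached to the pair `(h, φ)`. -/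
def BerwaldConn (h : ℝ → ℝ) (φ φinv : (Fin n → ℝ) → Fin n → Fin n → ℝ) : Conn n :=
  ⟨chr h, fun _ _ => 0, fun k i j => liftX (gam φ φinv k i j), fun _ _ _ => 0⟩

end Jet

namespace Jet

/-- A spatial partial derivative is the Fréchet derivative along a basis vector. -/
theorem pxn_eq_fderiv {n : ℕ} (i : Fin n) {f : (Fin n → ℝ) → ℝ} (hf : Differentiable ℝ f) :
    pxn i f = fun x => fderiv ℝ f x (Pi.single i 1) := by
  funext x
  have hu : HasDerivAt (Function.update x i) (Pi.single i (1 : ℝ)) (x i) :=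
    hasDerivAt_update x i (x i)
  have hfx : HasFDerivAt f (fderiv ℝ f x) (Function.update x i (x i)) := by
    rw [Function.update_eq_self]
    exact (hf x).hasFDerivAt
  exact (hfx.comp_hasDerivAt (x i) hu).deriv

theorem contDiff_pxn {n : ℕ} (i : Fin n) {f : (Fin n → ℝ) → ℝ}
    (hf : ContDiff ℝ (⊤ : ℕ∞) f) : ContDiff ℝ (⊤ : ℕ∞) (pxn i f) := by
  rw [pxn_eq_fderiv i (hf.differentiable (by simp))]
  exact (hf.fderiv_right (m := (⊤ : ℕ∞)) (by norm_cast)).clm_apply contDiff_const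

theorem contDiff_gam {n : ℕ} {φ φinv : (Fin n → ℝ) → Fin n → Fin n → ℝ}
    (hφs : ∀ i j, ContDiff ℝ (⊤ : ℕ∞) (fun x => φ x i j))
    (hφinvs : ∀ i j, ContDiff ℝ (⊤ : ℕ∞) (fun x => φinv x i j)) (i j k : Fin n) :
    ContDiff ℝ (⊤ : ℕ∞) (gam φ φinv i j k) :=
  ContDiff.sum fun m _ => ((hφinvs i m).div_const 2).mul
    (((contDiff_pxn k (hφs j m)).add (contDiff_pxn j (hφs k m))).sub (contDiff_pxn m (hφs j k)))

theorem gam_symm {n : ℕ} {φ : (Fin n → ℝ) → Fin n → Fin n → ℝ}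
    (hφsym : ∀ x i j, φ x i j = φ x j i) (φinv : (Fin n → ℝ) → Fin n → Fin n → ℝ)
    (i j k : Fin n) : gam φ φinv i j k = gam φ φinv i k j := by
  funext x
  have hjk : (fun z => φ z j k) = fun z => φ z k j := funext fun z => hφsym z j k
  simp only [gam, hjk]
  exact Finset.sum_congr rfl fun m _ => by ring

theorem hasDerivAt_update_apply {n : ℕ} (y : Fin n → ℝ) (i m : Fin n) :
    HasDerivAt (fun s => Function.update y i s m) (if m = i then 1 else 0) (y i) := by
  simpa [Pi.single_apply] using hasDerivAt_pi.1 (hasDerivAt_update y i (y i)) m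

theorem MB_apply {n : ℕ} (h : ℝ → ℝ) (r : Fin n) (t : ℝ) (x y : Fin n → ℝ) :
    MB h r t x y = -(deriv h t / (2 * h t) * y r) := rfl

theorem NB_apply {n : ℕ} (φ φinv : (Fin n → ℝ) → Fin n → Fin n → ℝ) (i j : Fin n)
    (t : ℝ) (x y : Fin n → ℝ) : NB φ φinv i j t x y = ∑ m, gam φ φinv i j m x * y m := by
  simp [NB, Finset.sum_apply, liftX, yc]

theorem dt_apply {n : ℕ} (M : Fin n → Fn n) (F : Fn n) (t : ℝ) (x y : Fin n → ℝ) :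
    dt M F t x y = pt F t x y - ∑ r, M r t x y * py r F t x y := by
  simp [dt, Finset.sum_apply]

theorem dx_apply {n : ℕ} (N : Fin n → Fin n → Fn n) (k : Fin n) (F : Fn n) (t : ℝ)
    (x y : Fin n → ℝ) : dx N k F t x y = px k F t x y - ∑ r, N r k t x y * py r F t x y := by
  simp [dx, Finset.sum_apply]

theorem px_MB {n : ℕ} (h : ℝ → ℝ) (j r : Fin n) : px j (MB h r) = 0 := by
  funext t x y
  simp [px, MB_apply]

theorem py_MB {n : ℕ} (h : ℝ → ℝ) (j r : Fin n) (t : ℝ) (x y : Fin n → ℝ) :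
    py j (MB h r) t x y = -(deriv h t / (2 * h t) * if r = j then 1 else 0) :=
  ((hasDerivAt_update_apply y j r).const_mul (deriv h t / (2 * h t))).neg.deriv

theorem pt_NB {n : ℕ} (φ φinv : (Fin n → ℝ) → Fin n → Fin n → ℝ) (i j : Fin n) :
    pt (NB φ φinv i j) = 0 := by
  funext t x y
  simp [pt, NB_apply]

theorem py_NB {n : ℕ} (φ φinv : (Fin n → ℝ) → Fin n → Fin n → ℝ) (k i j : Fin n)
    (t : ℝ) (x y : Fin n → ℝ) : py k (NB φ φinv i j) t x y = gam φ φinv i j k x := by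
  have hd : HasDerivAt (fun s => ∑ m, gam φ φinv i j m x * Function.update y k s m)
      (∑ m, gam φ φinv i j m x * if m = k then 1 else 0) (y k) :=
    HasDerivAt.fun_sum fun m _ => (hasDerivAt_update_apply y k m).const_mul _
  simp only [py, NB_apply]
  simpa using hd.deriv

theorem px_NB {n : ℕ} {φ φinv : (Fin n → ℝ) → Fin n → Fin n → ℝ}
    (hγ : ∀ i j k, Differentiable ℝ (gam φ φinv i j k)) (k i j : Fin n)
    (t : ℝ) (x y : Fin n → ℝ) :
    px k (NB φ φinv i j) t x y = ∑ m, pxn k (gam φ φinv i j m) x * y m := by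
  have hd : HasDerivAt (fun s => ∑ m, gam φ φinv i j m (Function.update x k s) * y m)
      (∑ m, pxn k (gam φ φinv i j m) x * y m) (x k) := by
    refine HasDerivAt.fun_sum fun m _ => HasDerivAt.mul_const ?_ _
    exact ((hγ i j m _).comp (x k)
      (hasDerivAt_update x k (x k)).differentiableAt).hasDerivAt
  simp only [px, NB_apply]
  exact hd.deriv

theorem dx_NB {n : ℕ} {φ φinv : (Fin n → ℝ) → Fin n → Fin n → ℝ}
    (hγ : ∀ i j k, Differentiable ℝ (gam φ φinv i j k)) (k i j : Fin n)
    (t : ℝ) (x y : Fin n → ℝ) :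
    dx (NB φ φinv) k (NB φ φinv i j) t x y = ∑ m, (pxn k (gam φ φinv i j m) x
      - ∑ r, gam φ φinv r k m x * gam φ φinv i j r x) * y m := by
  simp only [dx_apply, px_NB hγ, py_NB, NB_apply, sub_mul, Finset.sum_sub_distrib,
    Finset.sum_mul]
  rw [Finset.sum_comm]
  congr 1
  exact Finset.sum_congr rfl fun m _ => Finset.sum_congr rfl fun r _ => by ring

/-- the torsion d-tensors of the Berwald connection attached to
the pair of Riemannian metrics (h, φ). -/
theorem berwald_torsion
    (n : ℕ) (hn : 1 ≤ n)
    (h : ℝ → ℝ) (hh : ContDiff ℝ (⊤ : ℕ∞) h) (hhpos : ∀ t, 0 < h t)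
    (φ φinv : (Fin n → ℝ) → Fin n → Fin n → ℝ)
    (hφs : ∀ i j, ContDiff ℝ (⊤ : ℕ∞) (fun x => φ x i j))
    (hφinvs : ∀ i j, ContDiff ℝ (⊤ : ℕ∞) (fun x => φinv x i j))
    (hφsym : ∀ x i j, φ x i j = φ x j i)
    (hφpos : ∀ x (v : Fin n → ℝ), v ≠ 0 → 0 < ∑ i, ∑ j, v i * φ x i j * v j)
    (hφinv : ∀ x i j, (∑ m, φinv x i m * φ x m j) = if i = j then (1 : ℝ) else 0) :
    (∀ r j, T1 (BerwaldConn h φ φinv) r j = 0)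
    ∧ (∀ r j, Rv1 (MB h) (NB φ φinv) r j = 0)
    ∧ (∀ r i j, Tsp (BerwaldConn h φ φinv) r i j = 0)
    ∧ (∀ r j, Pv1 (MB h) (BerwaldConn h φ φinv) r j = 0)
    ∧ (∀ r i j, Phsp (BerwaldConn h φ φinv) r i j = 0)
    ∧ (∀ r i j, Pvsp (NB φ φinv) (BerwaldConn h φ φinv) r i j = 0)
    ∧ (∀ r i j, Ssp (BerwaldConn h φ φinv) r i j = 0)
    ∧ (∀ k i j, Rvsp (MB h) (NB φ φinv) k i j
        = ∑ m, liftX (rphi φ φinv k m i j) * yc m) := by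
  have hγ : ∀ i j k, Differentiable ℝ (gam φ φinv i j k) := fun i j k =>
    (contDiff_gam hφs hφinvs i j k).differentiable (by simp)
  have hsym := gam_symm hφsym φinv
  refine ⟨fun r j => neg_zero, fun r j => ?_, fun r i j => ?_, fun r j => ?_,
    fun r i j => rfl, fun r i j => ?_, fun r i j => sub_self 0, fun k i j => ?_⟩
  · funext t x y
    simp only [Rv1, Pi.sub_apply, dx_apply, dt_apply, px_MB, py_MB, pt_NB, py_NB, MB_apply,
      NB_apply, Pi.zero_apply]
    simp only [mul_neg, neg_mul, mul_ite, mul_one, mul_zero, Finset.sum_neg_distrib,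
      Finset.sum_ite_eq, Finset.mem_univ, if_true, Finset.sum_mul, zero_sub, neg_neg]
    rw [sub_eq_zero]
    exact Finset.sum_congr rfl fun m _ => by ring
  · simp only [Tsp, BerwaldConn, hsym r i j, sub_self]
  · funext t x y
    by_cases hrj : r = j <;> simp [Pv1, BerwaldConn, py_MB, kron, chr, hrj]
  · funext t x y
    simp [Pvsp, BerwaldConn, py_NB, liftX, hsym r i j]
  · funext t x y
    simp only [Rvsp, Pi.sub_apply, dx_NB hγ, Finset.sum_apply, Pi.mul_apply, liftX, yc, rphi]
    rw [← Finset.sum_sub_distrib]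
    refine Finset.sum_congr rfl fun m _ => ?_
    rw [hsym k i m, hsym k j m, ← sub_mul]
    have hquad : ∀ a b : Fin n, ∑ r, gam φ φinv r a m x * gam φ φinv k b r x
        = ∑ r, gam φ φinv r m a x * gam φ φinv k r b x := fun a b =>
      Finset.sum_congr rfl fun r _ => by rw [hsym r a m, hsym k b r]
    rw [hquad j i, hquad i j]
    ring

end Jet
end
end

section
/- For the Berwald connection attached to the pair of Riemannian metrics (h, φ), endowed with the canonical nonlinear connection M^i = −κ y^i, N^i_j = γ^i_jm y^m, all curvature d-tensors vanish identically — R^l_i1k = 0, P^l_i1(k) = 0, P^l_ij(k) = 0, S^l_i(j)(k) = 0 — except R^l_ijk, which equals the curvature tensor r^l_ijk of the Christoffel symbols γ of φ. -/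
open Finset

noncomputable section

namespace Jet

variable {n : ℕ}

theorem pt_zero : pt (0 : Fn n) = 0 := by
  funext t x y
  simp [pt]

theorem px_zero (i : Fin n) : px i (0 : Fn n) = 0 := by
  funext t x y
  simp [px]

theorem py_zero (i : Fin n) : py i (0 : Fn n) = 0 := by
  funext t x y
  simp [py]

theorem dt_zero (M : Fin n → Fn n) : dt M 0 = 0 := by
  simp [dt, pt_zero, py_zero]

theorem dx_zero (N : Fin n → Fin n → Fn n) (k : Fin n) : dx N k 0 = 0 := by
  simp [dx, px_zero, py_zero]

theorem pt_liftX (f : (Fin n → ℝ) → ℝ) : pt (liftX f) = 0 := by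
  funext t x y
  simp [pt, liftX]

theorem py_liftX (i : Fin n) (f : (Fin n → ℝ) → ℝ) : py i (liftX f) = 0 := by
  funext t x y
  simp [py, liftX]

theorem dt_liftX (M : Fin n → Fn n) (f : (Fin n → ℝ) → ℝ) : dt M (liftX f) = 0 := by
  simp [dt, pt_liftX, py_liftX]

theorem dx_liftX (N : Fin n → Fin n → Fn n) (k : Fin n) (f : (Fin n → ℝ) → ℝ) :
    dx N k (liftX f) = liftX (pxn k f) := by
  simp only [dx, py_liftX, mul_zero, sum_const_zero, sub_zero]
  rfl

/-- If the vertical coefficients `C` vanish, so do their temporal covariant derivatives. -/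
theorem covT_CT_of_C_eq_zero (M : Fin n → Fn n) (Γ : Conn n) (hC : Γ.C = 0) (p : ℤ)
    (σ : Fin 3 → IdxType) (a : Fin 3 → Fin n) : covT M Γ p σ (CT Γ) a = 0 := by
  have hCT : CT Γ = 0 := by
    funext a
    simp [CT, hC]
  simp only [covT, hCT, Pi.zero_apply (M := fun _ : Fin 3 → Fin n => Fn n), dt_zero, mul_zero,
    smul_zero, zero_mul, sum_const_zero, neg_zero, zero_add]
  refine sum_eq_zero fun q _ => ?_
  cases σ q <;> rfl

/-- If the vertical coefficients `C` vanish, so do their spatial covariant derivatives. -/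
theorem covX_CT_of_C_eq_zero (N : Fin n → Fin n → Fn n) (Γ : Conn n) (hC : Γ.C = 0)
    (σ : Fin 3 → IdxType) (k : Fin n) (a : Fin 3 → Fin n) : covX N Γ σ k (CT Γ) a = 0 := by
  have hCT : CT Γ = 0 := by
    funext a
    simp [CT, hC]
  simp only [covX, hCT, Pi.zero_apply (M := fun _ : Fin 3 → Fin n => Fn n), dx_zero,
    zero_mul, sum_const_zero, neg_zero, zero_add]
  refine sum_eq_zero fun q _ => ?_
  cases σ q <;> rfl

/-- the curvature d-tensors of the Berwald connection attached to
the pair of Riemannian metrics (h, φ). -/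
theorem berwald_curvature
    (n : ℕ) (hn : 1 ≤ n)
    (h : ℝ → ℝ) (hh : ContDiff ℝ (⊤ : ℕ∞) h) (hhpos : ∀ t, 0 < h t)
    (φ φinv : (Fin n → ℝ) → Fin n → Fin n → ℝ)
    (hφs : ∀ i j, ContDiff ℝ (⊤ : ℕ∞) (fun x => φ x i j))
    (hφinvs : ∀ i j, ContDiff ℝ (⊤ : ℕ∞) (fun x => φinv x i j))
    (hφsym : ∀ x i j, φ x i j = φ x j i)
    (hφpos : ∀ x (v : Fin n → ℝ), v ≠ 0 → 0 < ∑ i, ∑ j, v i * φ x i j * v j)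
    (hφinv : ∀ x i j, (∑ m, φinv x i m * φ x m j) = if i = j then (1 : ℝ) else 0) :
    (∀ l i k, Rc1 (MB h) (NB φ φinv) (BerwaldConn h φ φinv) l i k = 0)
    ∧ (∀ l i k, Pc1 (MB h) (NB φ φinv) (BerwaldConn h φ φinv) l i k = 0)
    ∧ (∀ l i j k, Pc (MB h) (NB φ φinv) (BerwaldConn h φ φinv) l i j k = 0)
    ∧ (∀ l i j k, Sc (BerwaldConn h φ φinv) l i j k = 0)
    ∧ (∀ l i j k, Rc (MB h) (NB φ φinv) (BerwaldConn h φ φinv) l i j k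
        = liftX (rphi φ φinv l i j k)) := by
  refine ⟨fun l i k => ?_, fun l i k => ?_, fun l i j k => ?_, fun l i j k => ?_,
    fun l i j k => ?_⟩
  · simp [Rc1, BerwaldConn, dx_zero, dt_liftX]
  · rw [Pc1, covT_CT_of_C_eq_zero _ _ rfl]
    simp [BerwaldConn, py_zero]
  · rw [Pc, covX_CT_of_C_eq_zero _ _ rfl]
    simp [BerwaldConn, py_liftX]
  · simp [Sc, BerwaldConn, py_zero]
  · funext t x y
    simp [Rc, BerwaldConn, dx_liftX, liftX, rphi]


end Jet
end
end
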